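/- Let G be a finite group and K a simplicial ℚ[G]-module. For any G-simplicial map f : EG → K, the map f̄ : EG → K defined on n-simplices by f̄(g_n,…,g_0) = (1/|G|) Σ_{σ∈G} f(σ, e, …, e) (where (σ, e, …, e) ∈ EG_n = G^{n+1}) is a G-simplicial map, and there is a G-equivariant simplicial homotopy H : EG × Δ¹ → K from f̄ to f, where G acts on EG × Δ¹ via its action on the EG factor. -/

import Mathlib

/-!
STATEMENT 5: Let `G` be a finite group and `K` a simplicial `ℚ[G]`-module.  For any
`G`-simplicial map `f : EG → K`, the map `f̄ : EG → K` defined on `n`-simplices by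
`f̄(g_n,…,g_0) = (1/|G|) Σ_{σ∈G} f(σ, e, …, e)` is a `G`-simplicial map, and there is a
`G`-equivariant simplicial homotopy `H : EG × Δ¹ → K` from `f̄` to `f` (with `G` acting
on `EG × Δ¹` via the `EG` factor).

Here a simplicial object is presented by its face and degeneracy maps (which generate all
simplicial operators); `EG` has `n`-simplices `G^{n+1}` (a tuple `(g_n,…,g_0)` is the
function `v : Fin (n+1) → G`, `v k = g_k`), with the face and degeneracy maps
`d₀(g_n,…,g_0) = (g_n,…,g_1)`, `d_i(g_n,…,g_0) = (g_n,…,g_{i+1}, g_i·g_{i−1},…,g_0)`,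
`s_j(g_n,…,g_0) = (g_n,…,g_j, e, g_{j−1},…,g_0)`, and the `G`-action
`g·(g_n,…,g_0) = (g·g_n, g_{n−1},…,g_0)`.  The 1-simplex `Δ¹` has `n`-simplices encoded
by a "cut" `c : Fin (n+2)` (the monotone map `[n] → [1]` sending `j` to `0` iff `j < c`).
-/

/-- A simplicial `ℚ[G]`-module, presented by face and degeneracy maps: a simplicial
object `K` in `ℚ`-vector spaces (levelwise vector spaces `V n`, linear faces `d` and
degeneracies `s` satisfying the simplicial identities) together with an action of `G` on
`K` by simplicial `ℚ`-linear automorphisms. -/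
structure SimplicialQModG (G : Type) [Group G] where
  V : ℕ → Type
  acg : ∀ n, AddCommGroup (V n)
  mod : ∀ n, Module ℚ (V n)
  d : ∀ n, Fin (n + 2) → (V (n + 1) →ₗ[ℚ] V n)
  s : ∀ n, Fin (n + 1) → (V n →ₗ[ℚ] V (n + 1))
  ρ : ∀ n, G → (V n →ₗ[ℚ] V n)
  ρ_one : ∀ n, ρ n 1 = LinearMap.id
  ρ_mul : ∀ n (g h : G), ρ n (g * h) = (ρ n g).comp (ρ n h)
  d_d : ∀ n (i j : Fin (n + 2)), i ≤ j → ∀ x : V (n + 2),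
    d n i (d (n + 1) j.succ x) = d n j (d (n + 1) i.castSucc x)
  s_s : ∀ n (i j : Fin (n + 1)), i ≤ j → ∀ x : V n,
    s (n + 1) i.castSucc (s n j x) = s (n + 1) j.succ (s n i x)
  d_s_le : ∀ n (i : Fin (n + 2)) (j : Fin (n + 1)), i ≤ j.castSucc → ∀ x : V (n + 1),
    d (n + 1) i.castSucc (s (n + 1) j.succ x) = s n j (d n i x)
  d_s_self : ∀ n (j : Fin (n + 1)) (x : V n), d n j.castSucc (s n j x) = x
  d_s_succ : ∀ n (j : Fin (n + 1)) (x : V n), d n j.succ (s n j x) = x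
  d_s_gt : ∀ n (i : Fin (n + 2)) (j : Fin (n + 1)), j.castSucc < i → ∀ x : V (n + 1),
    d (n + 1) i.succ (s (n + 1) j.castSucc x) = s n j (d n i x)
  ρ_d : ∀ n (i : Fin (n + 2)) (g : G) (x : V (n + 1)),
    d n i (ρ (n + 1) g x) = ρ n g (d n i x)
  ρ_s : ∀ n (j : Fin (n + 1)) (g : G) (x : V n),
    s n j (ρ n g x) = ρ (n + 1) g (s n j x)

attribute [instance] SimplicialQModG.acg SimplicialQModG.mod

section EG

variable (G : Type) [Group G]

/-- The `i`-th face map of `EG`, in the coordinates of the context: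
`d₀(g_n,…,g_0) = (g_n,…,g_1)` and
`d_i(g_n,…,g_0) = (g_n,…,g_{i+1}, g_i·g_{i−1}, g_{i−2},…,g_0)` for `1 ≤ i`.
(A tuple `(g_n,…,g_0)` is the function `v` with `v k = g_k`.) -/
def EGd (n : ℕ) (i : Fin (n + 2)) (v : Fin (n + 2) → G) : Fin (n + 1) → G := fun k =>
  if (k : ℕ) + 1 < (i : ℕ) then v k.castSucc
  else if (k : ℕ) + 1 = (i : ℕ) then v k.succ * v k.castSucc
  else v k.succ

/-- The `j`-th degeneracy map of `EG`: `s_j(g_n,…,g_0) = (g_n,…,g_j, e, g_{j−1},…,g_0)`. -/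
def EGs (n : ℕ) (j : Fin (n + 1)) (v : Fin (n + 1) → G) : Fin (n + 2) → G := fun k =>
  if h1 : (k : ℕ) < (j : ℕ) then v ⟨k, by have := j.isLt; omega⟩
  else if h2 : (k : ℕ) = (j : ℕ) then 1
  else v ⟨(k : ℕ) - 1, by have := k.isLt; omega⟩

/-- The `G`-action on `EG`: `g·(g_n,…,g_0) = (g·g_n, g_{n−1},…,g_0)`. -/
def EGact (n : ℕ) (g : G) (v : Fin (n + 1) → G) : Fin (n + 1) → G := fun k =>
  if k = Fin.last n then g * v k else v k

/-- The `i`-th face map of the standard 1-simplex `Δ¹`, whose `n`-simplices (monotone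
maps `[n] → [1]`) are encoded by their cut position `c : Fin (n+2)` (the map sending
`j ↦ 0` iff `j < c`): precomposition with `δ_i`. -/
def D1d (n : ℕ) (i : Fin (n + 2)) (c : Fin (n + 3)) : Fin (n + 2) :=
  if h : (c : ℕ) ≤ (i : ℕ) then ⟨c, by have := i.isLt; omega⟩
  else ⟨(c : ℕ) - 1, by have := c.isLt; omega⟩

/-- The `j`-th degeneracy map of `Δ¹` in the cut encoding: precomposition with `σ_j`. -/
def D1s (n : ℕ) (j : Fin (n + 1)) (c : Fin (n + 2)) : Fin (n + 3) :=
  if h : (c : ℕ) ≤ (j : ℕ) then ⟨c, by have := c.isLt; omega⟩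
  else ⟨(c : ℕ) + 1, by have := c.isLt; omega⟩

end EG

/-- The averaged map `f̄(g_n,…,g_0) = (1/|G|) Σ_{σ∈G} f(σ, e, …, e)`, where `(σ,e,…,e)`
is the `n`-simplex of `EG` with leftmost entry `σ` and all other entries `e`. -/
noncomputable def fbar {G : Type} [Group G] [Fintype G] (K : SimplicialQModG G)
    (f : ∀ n, (Fin (n + 1) → G) → K.V n) :
    ∀ n, (Fin (n + 1) → G) → K.V n := fun n _ =>
  (Fintype.card G : ℚ)⁻¹ •
    ∑ σ : G, f n (fun k => if k = Fin.last n then σ else 1)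

/-- The tuple obtained from `v` by keeping the entries at positions at least `c`, placing `τ` just
below them and `1` everywhere else. -/
def cutTuple {G : Type} [Group G] (n : ℕ) (v : Fin (n + 1) → G) (c : Fin (n + 2)) (τ : G) :
    Fin (n + 1) → G := fun k =>
  if (c : ℕ) ≤ (k : ℕ) then v k else if (k : ℕ) + 1 = (c : ℕ) then τ else 1

section cutTuple

variable {G : Type} [Group G]

lemma cutTuple_zero (n : ℕ) (v : Fin (n + 1) → G) (τ : G) : cutTuple n v 0 τ = v := by
  funext k
  simp [cutTuple]

lemma cutTuple_last (n : ℕ) (v : Fin (n + 1) → G) (τ : G) :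
    cutTuple n v (Fin.last (n + 1)) τ = fun k => if k = Fin.last n then τ else 1 := by
  funext k
  have := k.isLt
  simp only [cutTuple, Fin.ext_iff, Fin.val_last]
  split_ifs <;> first | rfl | omega

/-- Faces of a cut tuple are cut tuples, up to left translation of the free entry. -/
lemma exists_cutTuple_EGd (n : ℕ) (i : Fin (n + 2)) (v : Fin (n + 2) → G) (c : Fin (n + 3)) :
    ∃ a : G, ∀ τ : G,
      cutTuple n (EGd G n i v) (D1d n i c) (a * τ) = EGd G n i (cutTuple (n + 1) v c τ) := by
  by_cases h : (c : ℕ) = i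
  · refine ⟨v i, fun τ => funext fun k => ?_⟩
    have hk : (k : ℕ) + 1 = i → k.succ = i := fun hk => Fin.ext (by simpa using hk)
    simp only [cutTuple, EGd, D1d, Fin.val_succ, Fin.val_castSucc, h.le, ↓reduceDIte]
    split_ifs <;> first | omega | rfl | rw [hk (by omega)]
  · refine ⟨1, fun τ => funext fun k => ?_⟩
    by_cases hc : (c : ℕ) ≤ i <;>
      simp only [cutTuple, EGd, D1d, Fin.val_succ, Fin.val_castSucc, one_mul, hc, ↓reduceDIte] <;>
      split_ifs <;> first | omega | rfl | simp

lemma cutTuple_EGs (n : ℕ) (j : Fin (n + 1)) (v : Fin (n + 1) → G) (c : Fin (n + 2)) (τ : G) :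
    cutTuple (n + 1) (EGs G n j v) (D1s n j c) τ = EGs G n j (cutTuple n v c τ) := by
  funext k
  by_cases hc : (c : ℕ) ≤ j <;>
    simp only [cutTuple, EGs, D1s, hc, ↓reduceDIte] <;>
    split_ifs <;> first | omega | rfl

/-- The action of `G` preserves cut tuples, up to left translation of the free entry. -/
lemma exists_cutTuple_EGact (n : ℕ) (g : G) (v : Fin (n + 1) → G) (c : Fin (n + 2)) :
    ∃ a : G, ∀ τ : G,
      cutTuple n (EGact G n g v) c (a * τ) = EGact G n g (cutTuple n v c τ) := by
  by_cases h : c = Fin.last (n + 1)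
  · subst h
    refine ⟨g, fun τ => funext fun k => ?_⟩
    have := k.isLt
    simp only [cutTuple, EGact, Fin.ext_iff, Fin.val_last]
    split_ifs <;> first | rfl | omega
  · refine ⟨1, fun τ => funext fun k => ?_⟩
    have := c.isLt
    rw [Fin.ext_iff, Fin.val_last] at h
    simp only [cutTuple, EGact, Fin.ext_iff, Fin.val_last, one_mul]
    split_ifs <;> first | rfl | omega

lemma D1d_last (n : ℕ) (i : Fin (n + 2)) : D1d n i (Fin.last (n + 2)) = Fin.last (n + 1) := by
  have := i.isLt
  simp only [D1d, Fin.ext_iff, Fin.val_last]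
  split_ifs <;> first | omega | simp

lemma D1s_last (n : ℕ) (j : Fin (n + 1)) : D1s n j (Fin.last (n + 1)) = Fin.last (n + 2) := by
  have := j.isLt
  simp only [D1s, Fin.ext_iff, Fin.val_last]
  split_ifs <;> first | omega | simp

end cutTuple

/-- The average of `f` over the cut tuples of `v` at `c`. -/
noncomputable def cutAverage {G : Type} [Group G] [Fintype G] (K : SimplicialQModG G)
    (f : ∀ n, (Fin (n + 1) → G) → K.V n) (n : ℕ) (p : (Fin (n + 1) → G) × Fin (n + 2)) : K.V n :=
  (Fintype.card G : ℚ)⁻¹ • ∑ τ : G, f n (cutTuple n p.1 p.2 τ)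

section cutAverage

variable {G : Type} [Group G] [Fintype G] (K : SimplicialQModG G)
  (f : ∀ n, (Fin (n + 1) → G) → K.V n)

lemma cutAverage_last (n : ℕ) (v : Fin (n + 1) → G) :
    cutAverage K f n (v, Fin.last (n + 1)) = fbar K f n v := by
  simp only [cutAverage, fbar, cutTuple_last]

lemma cutAverage_zero (n : ℕ) (v : Fin (n + 1) → G) : cutAverage K f n (v, 0) = f n v := by
  have h : (Fintype.card G : ℚ) ≠ 0 := Nat.cast_ne_zero.mpr Fintype.card_ne_zero
  simp only [cutAverage, cutTuple_zero, Finset.sum_const, Finset.card_univ]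
  rw [← Nat.cast_smul_eq_nsmul ℚ, inv_smul_smul₀ h]

/-- A linear map carrying the values of `f` on one family of cut tuples to those on another, up to
left translation of the free entry, carries the first average to the second. -/
lemma cutAverage_eq_map {m n : ℕ} (L : K.V m →ₗ[ℚ] K.V n)
    (p : (Fin (m + 1) → G) × Fin (m + 2)) (q : (Fin (n + 1) → G) × Fin (n + 2)) (a : G)
    (h : ∀ τ, f n (cutTuple n q.1 q.2 (a * τ)) = L (f m (cutTuple m p.1 p.2 τ))) :
    cutAverage K f n q = L (cutAverage K f m p) := by
  simp only [cutAverage, map_smul, map_sum, ← h]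
  rw [← Equiv.sum_comp (Equiv.mulLeft a)]
  rfl

end cutAverage

/-- Let `G` be a finite group and `K` a simplicial `ℚ[G]`-module.  For
every `G`-simplicial map `f : EG → K` (a family of maps commuting with the face and
degeneracy maps and with the `G`-actions), the averaged map
`f̄(g_n,…,g_0) = (1/|G|) Σ_{σ∈G} f(σ,e,…,e)` is again a `G`-simplicial map `EG → K`, and
there is a `G`-equivariant simplicial homotopy `H : EG × Δ¹ → K` from `f̄` to `f`
(`G` acting on `EG × Δ¹` through the `EG` factor): `H` commutes with the (diagonal) face
and degeneracy maps of the product, is `G`-equivariant, restricts to `f̄` on the end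
`EG × {0}` of the cylinder, and to `f` on the end `EG × {1}`. -/
theorem averaged_map_simplicial_and_homotopy
    (G : Type) [Group G] [Fintype G] (K : SimplicialQModG G)
    (f : ∀ n, (Fin (n + 1) → G) → K.V n)
    (hfd : ∀ n (i : Fin (n + 2)) (v : Fin (n + 2) → G),
      f n (EGd G n i v) = K.d n i (f (n + 1) v))
    (hfs : ∀ n (j : Fin (n + 1)) (v : Fin (n + 1) → G),
      f (n + 1) (EGs G n j v) = K.s n j (f n v))
    (hfG : ∀ n (g : G) (v : Fin (n + 1) → G),
      f n (EGact G n g v) = K.ρ n g (f n v)) :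
    -- f̄ is a G-simplicial map EG → K
    ((∀ n (i : Fin (n + 2)) (v : Fin (n + 2) → G),
        fbar K f n (EGd G n i v) = K.d n i (fbar K f (n + 1) v)) ∧
     (∀ n (j : Fin (n + 1)) (v : Fin (n + 1) → G),
        fbar K f (n + 1) (EGs G n j v) = K.s n j (fbar K f n v)) ∧
     (∀ n (g : G) (v : Fin (n + 1) → G),
        fbar K f n (EGact G n g v) = K.ρ n g (fbar K f n v))) ∧
    -- and there is a G-equivariant simplicial homotopy H : EG × Δ¹ → K from f̄ to f
    ∃ H : ∀ n, ((Fin (n + 1) → G) × Fin (n + 2)) → K.V n,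
      (∀ n (i : Fin (n + 2)) (v : Fin (n + 2) → G) (c : Fin (n + 3)),
        H n (EGd G n i v, D1d n i c) = K.d n i (H (n + 1) (v, c))) ∧
      (∀ n (j : Fin (n + 1)) (v : Fin (n + 1) → G) (c : Fin (n + 2)),
        H (n + 1) (EGs G n j v, D1s n j c) = K.s n j (H n (v, c))) ∧
      (∀ n (g : G) (v : Fin (n + 1) → G) (c : Fin (n + 2)),
        H n (EGact G n g v, c) = K.ρ n g (H n (v, c))) ∧
      (∀ n (v : Fin (n + 1) → G), H n (v, Fin.last (n + 1)) = fbar K f n v) ∧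
      (∀ n (v : Fin (n + 1) → G), H n (v, 0) = f n v) := by
  have hd (n : ℕ) (i : Fin (n + 2)) (v : Fin (n + 2) → G) (c : Fin (n + 3)) :
      cutAverage K f n (EGd G n i v, D1d n i c) = K.d n i (cutAverage K f (n + 1) (v, c)) := by
    obtain ⟨a, ha⟩ := exists_cutTuple_EGd n i v c
    exact cutAverage_eq_map K f _ _ _ a fun τ => by rw [ha, hfd]
  have hs (n : ℕ) (j : Fin (n + 1)) (v : Fin (n + 1) → G) (c : Fin (n + 2)) :
      cutAverage K f (n + 1) (EGs G n j v, D1s n j c) = K.s n j (cutAverage K f n (v, c)) :=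
    cutAverage_eq_map K f _ _ _ 1 fun τ => by rw [one_mul, cutTuple_EGs, hfs]
  have hG (n : ℕ) (g : G) (v : Fin (n + 1) → G) (c : Fin (n + 2)) :
      cutAverage K f n (EGact G n g v, c) = K.ρ n g (cutAverage K f n (v, c)) := by
    obtain ⟨a, ha⟩ := exists_cutTuple_EGact n g v c
    exact cutAverage_eq_map K f _ _ _ a fun τ => by rw [ha, hfG]
  refine ⟨⟨fun n i v => ?_, fun n j v => ?_, fun n g v => ?_⟩,
    cutAverage K f, hd, hs, hG, cutAverage_last K f, cutAverage_zero K f⟩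
  · simpa only [D1d_last, cutAverage_last] using hd n i v (Fin.last (n + 2))
  · simpa only [D1s_last, cutAverage_last] using hs n j v (Fin.last (n + 1))
  · simpa only [cutAverage_last] using hG n g v (Fin.last (n + 1))
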